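/- (Proposition 2: Accelerated proximal-gradient method, convex case.) Consider the accelerated inexact proximal-gradient method: y_k = x_k + ((k−1)/(k+2))(x_k − x_{k-1}) with y_0 = x_0, and for each k ≥ 1, x_k is an ε_k-optimal solution of the proximal problem at y_{k-1} − (1/L)(g'(y_{k-1}) + e_k). Define Ã_k = Σ_{i=1}^k i ( ‖e_i‖/L + √(2ε_i/L) ) and B̃_k = Σ_{i=1}^k i² ε_i / L. Then for all k ≥ 1, f(x_k) − f(x*) ≤ (2L/(k+1)²) ( ‖x_0 − x*‖ + 2Ã_k + √(2B̃_k) )². -/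

import Mathlib

open scoped RealInnerProductSpace
open Finset

noncomputable section

variable {E : Type*} [NormedAddCommGroup E] [InnerProductSpace ℝ E] [CompleteSpace E]

/-- The ε-subdifferential of an `EReal`-valued function `a` at `x`:
the set of `y` such that `a t ≥ a x + ⟪y, t - x⟫ - ε` for all `t`. -/
def epsSubdiff (a : E → EReal) (ε : ℝ) (x : E) : Set E :=
  {y | ∀ t : E, a x + ((⟪y, t - x⟫ : ℝ) : EReal) - ((ε : ℝ) : EReal) ≤ a t}

/-- The objective function of the proximal problem at `y`. -/
def proxObj (L : ℝ) (h : E → EReal) (y x : E) : EReal :=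
  ((L / 2 * ‖x - y‖ ^ 2 : ℝ) : EReal) + h x

/-- `x` is an `ε`-optimal solution of the proximal problem at `y`. -/
def IsEpsOptimal (L : ℝ) (h : E → EReal) (ε : ℝ) (y x : E) : Prop :=
  proxObj L h y x ≤ ((ε : ℝ) : EReal) + ⨅ z : E, proxObj L h y z

/-- Convexity for `EReal`-valued functions. -/
def ERealConvexOn (h : E → EReal) : Prop :=
  ∀ x y : E, ∀ a b : ℝ, 0 ≤ a → 0 ≤ b → a + b = 1 →
    h (a • x + b • y) ≤ ((a : ℝ) : EReal) * h x + ((b : ℝ) : EReal) * h y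

/-- The restriction of a function with a gradient to a line. -/
lemma HasGradientAt.hasDerivAt_comp_line {g : E → ℝ} {g' : E → E}
    (hgrad : ∀ w, HasGradientAt g (g' w) w) (y d : E) (s : ℝ) :
    HasDerivAt (fun s : ℝ => g (y + s • d)) ⟪g' (y + s • d), d⟫ s := by
  have hline : HasDerivAt (fun s : ℝ => y + s • d) d s := by
    simpa using ((hasDerivAt_id s).smul_const d).const_add y
  simpa [Function.comp_def] using
    (hgrad (y + s • d)).hasFDerivAt.comp_hasDerivAt s hline

/-- The gradient inequality for a differentiable convex function. -/
lemma ConvexOn.add_inner_gradient_le {g : E → ℝ} {g' : E → E}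
    (hg : ConvexOn ℝ Set.univ g) (hgrad : ∀ w, HasGradientAt g (g' w) w) (y t : E) :
    g y + ⟪g' y, t - y⟫ ≤ g t := by
  have hconv : ConvexOn ℝ Set.univ (fun s : ℝ => g (y + s • (t - y))) := by
    refine ⟨convex_univ, fun a _ b _ p q hp hq hpq => ?_⟩
    have h1 := hg.2 (Set.mem_univ (y + a • (t - y))) (Set.mem_univ (y + b • (t - y))) hp hq hpq
    convert h1 using 2
    obtain rfl : q = 1 - p := by linarith
    simp only [smul_eq_mul]
    module
  have hder := HasGradientAt.hasDerivAt_comp_line hgrad y (t - y) 0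
  have := hconv.le_slope_of_hasDerivAt (Set.mem_univ 0) (Set.mem_univ 1) one_pos hder
  simp [slope_def_field] at this
  linarith

/-- The descent lemma: the quadratic upper bound for a function with Lipschitz gradient. -/
lemma le_add_inner_gradient_add_sq {L : ℝ} {g : E → ℝ} {g' : E → E}
    (hgrad : ∀ w, HasGradientAt g (g' w) w)
    (hlip : ∀ w w', ‖g' w - g' w'‖ ≤ L * ‖w - w'‖) (y x : E) :
    g x ≤ g y + ⟪g' y, x - y⟫ + L / 2 * ‖x - y‖ ^ 2 := by
  set d := x - y with hd
  have hder : ∀ s : ℝ, HasDerivAt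
      (fun s : ℝ => g (y + s • d) - s * ⟪g' y, d⟫ - s ^ 2 * (L / 2 * ‖d‖ ^ 2))
      (⟪g' (y + s • d), d⟫ - ⟪g' y, d⟫ - s * (L * ‖d‖ ^ 2)) s := by
    intro s
    have h1 := HasGradientAt.hasDerivAt_comp_line hgrad y d s
    have h2 := (hasDerivAt_id s).mul_const ⟪g' y, d⟫
    have h3 := ((hasDerivAt_id s).pow 2).mul_const (L / 2 * ‖d‖ ^ 2)
    refine ((h1.sub h2).sub h3).congr_deriv ?_
    simp
    ring
  have hanti : AntitoneOn
      (fun s : ℝ => g (y + s • d) - s * ⟪g' y, d⟫ - s ^ 2 * (L / 2 * ‖d‖ ^ 2))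
      (Set.Icc 0 1) := by
    refine antitoneOn_of_hasDerivWithinAt_nonpos (convex_Icc 0 1)
      (fun s _ => (hder s).continuousAt.continuousWithinAt)
      (fun s _ => (hder s).hasDerivWithinAt) fun s hs => ?_
    rw [interior_Icc] at hs
    have h1 : ⟪g' (y + s • d) - g' y, d⟫ ≤ L * (s * ‖d‖) * ‖d‖ := by
      refine (real_inner_le_norm _ _).trans ?_
      gcongr
      simpa [norm_smul, abs_of_pos hs.1] using hlip (y + s • d) y
    rw [inner_sub_left] at h1
    nlinarith
  have := hanti (Set.left_mem_Icc.2 zero_le_one) (Set.right_mem_Icc.2 zero_le_one) zero_le_one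
  simp [hd] at this
  linarith

lemma ERealConvexOn.le_coe {F : Type*} [NormedAddCommGroup F] [InnerProductSpace ℝ F]
    {h : F → EReal} (hh : ERealConvexOn h) {x y : F} {α β : ℝ} (hx : h x = α) (hy : h y = β)
    {a b : ℝ} (ha : 0 ≤ a) (hb : 0 ≤ b) (hab : a + b = 1) :
    h (a • x + b • y) ≤ ((a * α + b * β : ℝ) : EReal) := by
  have := hh x y a b ha hb hab
  rw [hx, hy] at this
  exact_mod_cast this

lemma IsEpsOptimal.ne_top {F : Type*} [NormedAddCommGroup F] [InnerProductSpace ℝ F]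
    {L ε : ℝ} {h : F → EReal} {z x : F} (hopt : IsEpsOptimal L h ε z x)
    {t : F} (ht : h t ≠ ⊤) : h x ≠ ⊤ := by
  intro hx
  have h1 : proxObj L h z x ≤ (ε : EReal) + proxObj L h z t :=
    hopt.trans (by gcongr; exact iInf_le _ t)
  rw [proxObj, proxObj, hx, EReal.coe_add_top, top_le_iff] at h1
  exact EReal.add_ne_top (EReal.coe_ne_top _) (EReal.add_ne_top (EReal.coe_ne_top _) ht) h1

/-- An `ε`-optimal point of the proximal problem satisfies the subgradient inequality of `h` up to
an error controlled by `ε`. -/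
lemma IsEpsOptimal.subgradient_inequality {F : Type*} [NormedAddCommGroup F]
    [InnerProductSpace ℝ F] {L ε : ℝ} (hL : 0 < L) (hε : 0 ≤ ε) {h : F → EReal}
    (hh : ERealConvexOn h) {z x t : F} (hopt : IsEpsOptimal L h ε z x)
    {α β : ℝ} (hx : h x = α) (ht : h t = β) :
    α + L * ⟪z - x, t - x⟫ ≤ β + ε + L * √(2 * ε / L) * ‖t - x‖ := by
  have key : ∀ θ : ℝ, 0 ≤ θ → θ ≤ 1 →
      θ * α + θ * (L * ⟪z - x, t - x⟫) ≤ θ * β + ε + L / 2 * θ ^ 2 * ‖t - x‖ ^ 2 := by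
    intro θ h0 h1
    set w := (1 - θ) • x + θ • t with hw
    have hconv := hh.le_coe hx ht (sub_nonneg.2 h1) h0 (by ring)
    have hle : proxObj L h z x ≤ (ε : EReal) + proxObj L h z w :=
      hopt.trans (by gcongr; exact iInf_le _ w)
    have hle' : proxObj L h z x ≤
        (ε : EReal) + (((L / 2 * ‖w - z‖ ^ 2 : ℝ) : EReal) +
          (((1 - θ) * α + θ * β : ℝ) : EReal)) :=
      hle.trans (by unfold proxObj; gcongr)
    rw [proxObj, hx] at hle'
    have hreal : L / 2 * ‖x - z‖ ^ 2 + α ≤ ε + (L / 2 * ‖w - z‖ ^ 2 + ((1 - θ) * α + θ * β)) := by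
      exact_mod_cast hle'
    have hexp : ‖w - z‖ ^ 2 = ‖x - z‖ ^ 2 - 2 * θ * ⟪z - x, t - x⟫ + θ ^ 2 * ‖t - x‖ ^ 2 := by
      have : w - z = (x - z) + θ • (t - x) := by rw [hw]; module
      rw [this, norm_add_sq_real, inner_smul_right, norm_smul, mul_pow, Real.norm_eq_abs, sq_abs,
        ← neg_sub z x, inner_neg_left]
      ring
    rw [hexp] at hreal
    linarith
  set r := √(2 * ε / L) with hr
  have hr0 : 0 ≤ r := Real.sqrt_nonneg _
  have hr2 : L * r ^ 2 = 2 * ε := by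
    rw [hr, Real.sq_sqrt (by positivity)]
    field_simp
  rcases le_or_gt ‖t - x‖ r with hcase | hcase
  · have := key 1 zero_le_one le_rfl
    have h2 : L * ‖t - x‖ * ‖t - x‖ ≤ L * r * ‖t - x‖ := by gcongr
    have h3 : 0 ≤ L * r * ‖t - x‖ := by positivity
    nlinarith
  · have hn : 0 < ‖t - x‖ := hr0.trans_lt hcase
    rcases hr0.eq_or_lt with hr00 | hrpos
    · rw [← hr00] at hr2 ⊢
      have hε0 : ε = 0 := by linarith
      by_contra! hcon
      set c := α + L * ⟪z - x, t - x⟫ - β with hc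
      have hcpos : 0 < c := by linarith
      set θ := min 1 (c / (L * ‖t - x‖ ^ 2)) with hθ
      have hθ0 : 0 < θ := lt_min one_pos (by positivity)
      have h1 := key θ hθ0.le (min_le_left _ _)
      have h2 : θ * (L * ‖t - x‖ ^ 2) ≤ c := by
        rw [← le_div_iff₀ (by positivity)]; exact min_le_right _ _
      have h3 : θ * c ≤ θ * (c / 2) := by nlinarith
      nlinarith
    · set θ := r / ‖t - x‖ with hθ
      have hθ0 : 0 < θ := by positivity
      have hθr : θ * ‖t - x‖ = r := by rw [hθ]; field_simp
      have h1 := key θ hθ0.le ((div_le_one hn).2 hcase.le)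
      have h2 : ε = θ * (L * r / 2 * ‖t - x‖) := by linear_combination (-1/2) * hr2 - L * r / 2 * hθr
      have h3 : L / 2 * θ ^ 2 * ‖t - x‖ ^ 2 = θ * (L * r / 2 * ‖t - x‖) := by
        linear_combination L / 2 * θ * ‖t - x‖ * hθr
      have h4 : θ * (α + L * ⟪z - x, t - x⟫) ≤ θ * (β + L * r * ‖t - x‖) := by linarith
      linarith [le_of_mul_le_mul_left h4 hθ0]

/-- One step of the inexact proximal-gradient method, compared with an arbitrary point `t`. -/
lemma IsEpsOptimal.gradient_step {L : ℝ} (hL : 0 < L) {g : E → ℝ} {g' : E → E}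
    (hgconv : ConvexOn ℝ Set.univ g) (hgrad : ∀ w, HasGradientAt g (g' w) w)
    (hlip : ∀ w w', ‖g' w - g' w'‖ ≤ L * ‖w - w'‖) {h : E → EReal} (hh : ERealConvexOn h)
    {ε : ℝ} (hε : 0 ≤ ε) {x y e t : E}
    (hopt : IsEpsOptimal L h ε (y - (1 / L) • (g' y + e)) x)
    {α β : ℝ} (hx : h x = α) (ht : h t = β) :
    g x + α ≤ g t + β + L / 2 * (‖y - t‖ ^ 2 - ‖x - t‖ ^ 2)
      + L * (‖e‖ / L + √(2 * ε / L)) * ‖x - t‖ + ε := by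
  have h1 := le_add_inner_gradient_add_sq hgrad hlip y x
  have h2 := hgconv.add_inner_gradient_le hgrad y t
  have h3 := hopt.subgradient_inequality hL hε hh hx ht
  have h4 : L * ⟪y - (1 / L) • (g' y + e) - x, t - x⟫ =
      L * ⟪y - x, t - x⟫ - ⟪g' y, t - x⟫ - ⟪e, t - x⟫ := by
    have : y - (1 / L) • (g' y + e) - x = (y - x) - (1 / L) • (g' y + e) := by module
    rw [this, inner_sub_left, inner_smul_left, inner_add_left]
    simp
    field_simp
    ring
  have h5 : ‖y - t‖ ^ 2 = ‖x - y‖ ^ 2 - 2 * ⟪y - x, t - x⟫ + ‖x - t‖ ^ 2 := by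
    have : y - t = (y - x) - (t - x) := by module
    rw [this, norm_sub_sq_real, norm_sub_rev y x, norm_sub_rev t x]
  have h6 : ⟪e, t - x⟫ ≤ ‖e‖ * ‖x - t‖ := by
    rw [norm_sub_rev x t]; exact real_inner_le_norm _ _
  have h7 : ⟪g' y, x - y⟫ = ⟪g' y, t - y⟫ - ⟪g' y, t - x⟫ := by
    rw [← inner_sub_right]; congr 1; module
  have h8 : L * (‖e‖ / L + √(2 * ε / L)) = ‖e‖ + L * √(2 * ε / L) := by field_simp
  rw [h4, norm_sub_rev t x] at h3
  rw [h5, h8]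
  linarith

/-- Solving a quadratic recursive inequality: if `D k + u k ^ 2` is bounded by a nondecreasing
quantity plus a weighted sum of the `u i`, then `D k` is bounded explicitly. -/
lemma le_sq_of_add_sq_le_add_sum {D u lam B : ℕ → ℝ} {c : ℝ} (hc : 0 ≤ c)
    (hu : ∀ i, 0 ≤ u i) (hlam : ∀ i, 0 ≤ lam i) (hD : ∀ i, 1 ≤ i → 0 ≤ D i)
    (hB0 : ∀ i, 0 ≤ B i) (hB : Monotone B)
    (hrec : ∀ i, 1 ≤ i → D i + u i ^ 2 ≤ c ^ 2 + B i + ∑ j ∈ Icc 1 i, 2 * lam j * u j)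
    {k : ℕ} (hk : 1 ≤ k) :
    D k ≤ (c + 2 * ∑ j ∈ Icc 1 k, lam j + √(B k)) ^ 2 := by
  set A := ∑ j ∈ Icc 1 k, lam j with hA
  have hA0 : 0 ≤ A := sum_nonneg fun i _ => hlam i
  set s := √(B k) with hs
  have hs0 : 0 ≤ s := Real.sqrt_nonneg _
  have hs2 : s ^ 2 = B k := Real.sq_sqrt (hB0 k)
  obtain ⟨m, hm, hmax⟩ := (Icc 1 k).exists_max_image u ⟨1, by simpa using hk⟩
  have hsum : ∀ i ≤ k, ∑ j ∈ Icc 1 i, 2 * lam j * u j ≤ 2 * A * u m := by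
    intro i hi
    calc ∑ j ∈ Icc 1 i, 2 * lam j * u j
        ≤ ∑ j ∈ Icc 1 k, 2 * lam j * u j :=
          sum_le_sum_of_subset_of_nonneg (Icc_subset_Icc_right hi)
            fun j _ _ => mul_nonneg (mul_nonneg zero_le_two (hlam j)) (hu j)
      _ ≤ ∑ j ∈ Icc 1 k, 2 * lam j * u m :=
          sum_le_sum fun j hj =>
            mul_le_mul_of_nonneg_left (hmax j hj) (mul_nonneg zero_le_two (hlam j))
      _ = 2 * A * u m := by rw [hA, ← sum_mul, ← mul_sum]
  obtain ⟨hm1, hmk⟩ := mem_Icc.1 hm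
  have h1 := hrec m hm1
  have h2 := hsum m hmk
  have h3 := hB hmk
  have h4 := hD m hm1
  have hum : u m ≤ c + 2 * A + s := by
    by_contra! hcon
    nlinarith [mul_nonneg hc hs0, mul_nonneg hA0 hc, mul_nonneg hA0 hs0, hu m]
  have h5 := hrec k hk
  have h6 := hsum k le_rfl
  nlinarith [mul_nonneg hc hs0, mul_nonneg hA0 hc, mul_nonneg hA0 hs0, sq_nonneg (u k),
    mul_le_mul_of_nonneg_left hum hA0]

theorem stmt_10
    (L : ℝ) (hL : 0 < L)
    (g : E → ℝ) (g' : E → E)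
    (hgconv : ConvexOn ℝ Set.univ g)
    (hgrad : ∀ w, HasGradientAt g (g' w) w)
    (hlip : ∀ w w', ‖g' w - g' w'‖ ≤ L * ‖w - w'‖)
    (h : E → EReal)
    (hhconv : ERealConvexOn h)
    (hhlsc : LowerSemicontinuous h)
    (hhproper : ∃ w, h w ≠ ⊤) (hhnbot : ∀ w, h w ≠ ⊥)
    (f : E → EReal) (hf : ∀ w, f w = ((g w : ℝ) : EReal) + h w)
    (xstar : E) (hmin : ∀ w, f xstar ≤ f w)
    (x y e : ℕ → E) (ε : ℕ → ℝ) (hεnn : ∀ k, 0 ≤ ε k)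
    (hy0 : y 0 = x 0)
    (hy : ∀ k, 1 ≤ k → y k = x k + (((k : ℝ) - 1) / ((k : ℝ) + 2)) • (x k - x (k - 1)))
    (hstep : ∀ k, 1 ≤ k →
      IsEpsOptimal L h (ε k) (y (k - 1) - (1 / L) • (g' (y (k - 1)) + e k)) (x k))
    (At Bt : ℕ → ℝ)
    (hAt : ∀ k, At k = ∑ i ∈ Icc 1 k, (i : ℝ) * (‖e i‖ / L + Real.sqrt (2 * ε i / L)))
    (hBt : ∀ k, Bt k = ∑ i ∈ Icc 1 k, (i : ℝ) ^ 2 * ε i / L)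
    :
    ∀ k, 1 ≤ k →
      f (x k) - f xstar ≤
        ((2 * L / ((k : ℝ) + 1) ^ 2 *
          (‖x 0 - xstar‖ + 2 * At k + Real.sqrt (2 * Bt k)) ^ 2 : ℝ) : EReal) := by
  have hhs : h xstar ≠ ⊤ := by
    obtain ⟨w, hw⟩ := hhproper
    intro htop
    have := hmin w
    rw [hf, hf, htop, EReal.coe_add_top, top_le_iff] at this
    exact EReal.add_ne_top (EReal.coe_ne_top _) hw this
  have hcoe : ∀ w, h w ≠ ⊤ → h w = ((h w).toReal : EReal) := fun w hw =>
    (EReal.coe_toReal hw (hhnbot w)).symm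
  have hxk : ∀ k, 1 ≤ k → h (x k) ≠ ⊤ := fun k hk => (hstep k hk).ne_top hhs
  set F : E → ℝ := fun w => g w + (h w).toReal with hF
  have hfF : ∀ w, h w ≠ ⊤ → f w = (F w : EReal) := fun w hw => by
    rw [hf, hcoe w hw]; simp [hF]
  set δ : ℕ → ℝ := fun k => F (x k) - F xstar with hδ
  have hδ0 : ∀ k, 1 ≤ k → 0 ≤ δ k := fun k hk => by
    have := hmin (x k)
    rw [hfF _ hhs, hfF _ (hxk k hk)] at this
    exact sub_nonneg.2 (by exact_mod_cast this)
  set v : ℕ → E := fun k => x (k - 1) + (((k : ℝ) + 1) / 2) • (x k - x (k - 1)) with hv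
  set u : ℕ → ℝ := fun k => ‖v k - xstar‖ with hu
  set a : ℕ → ℝ := fun k => ‖e k‖ / L + √(2 * ε k / L) with ha
  have ha0 : ∀ k, 0 ≤ a k := fun k => by positivity
  have hyv : ∀ n : ℕ, y n = (1 - 2 / ((n : ℝ) + 2)) • x n + (2 / ((n : ℝ) + 2)) • v n := by
    intro n
    rcases Nat.eq_zero_or_pos n with rfl | hn
    · simp [hv, hy0]
    · rw [hy n hn, hv]
      have hn2 : (n : ℝ) + 2 ≠ 0 := by positivity
      match_scalars <;> field_simp <;> ring
  have hrec : ∀ n : ℕ, ((n : ℝ) + 2) ^ 2 / (2 * L) * δ (n + 1) + u (n + 1) ^ 2 ≤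
      (n : ℝ) * (n + 2) / (2 * L) * δ n + u n ^ 2
        + 2 * (((n + 1 : ℕ) : ℝ) * a (n + 1)) * u (n + 1)
        + 2 * (((n + 1 : ℕ) : ℝ) ^ 2 * ε (n + 1) / L) := by
    intro n
    have hn2 : (0 : ℝ) < n + 2 := by positivity
    set θ : ℝ := 2 / (n + 2) with hθ
    have hθ0 : 0 < θ := by positivity
    have hθ1 : θ ≤ 1 := by rw [hθ, div_le_one hn2]; linarith [n.cast_nonneg (α := ℝ)]
    have hθn : θ * (n + 2) = 2 := by rw [hθ]; field_simp
    set t : E := (1 - θ) • x n + θ • xstar with ht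
    have hyt : y n - t = θ • (v n - xstar) := by rw [hyv, ht]; module
    have hxt : x (n + 1) - t = θ • (v (n + 1) - xstar) := by
      have hθv : θ • v (n + 1) = θ • x n + (x (n + 1) - x n) := by
        have : θ * (((n : ℝ) + 1 + 1) / 2) = 1 := by linear_combination hθn / 2
        simp only [hv, Nat.add_sub_cancel, Nat.cast_add, Nat.cast_one, smul_add, smul_smul, this,
          one_smul]
      rw [smul_sub, hθv, ht]; module
    obtain ⟨β, hβ, hβle⟩ : ∃ β : ℝ, h t = β ∧
        g t + β ≤ (1 - θ) * F (x n) + θ * F xstar := by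
      rcases Nat.eq_zero_or_pos n with rfl | hn
      · have hθ' : θ = 1 := by rw [hθ]; norm_num
        have htx : t = xstar := by rw [ht, hθ']; simp
        exact ⟨_, by rw [htx]; exact hcoe _ hhs, by rw [hθ', htx]; simp [hF]⟩
      · have hle := hhconv.le_coe (hcoe _ (hxk n hn)) (hcoe _ hhs) (sub_nonneg.2 hθ1) hθ0.le
          (sub_add_cancel _ _)
        have htop : h t ≠ ⊤ := fun h' => by
          rw [← ht, h', top_le_iff] at hle; exact EReal.coe_ne_top _ hle
        refine ⟨_, hcoe _ htop, ?_⟩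
        have hg := hgconv.2 (Set.mem_univ (x n)) (Set.mem_univ xstar) (sub_nonneg.2 hθ1) hθ0.le
          (sub_add_cancel _ _)
        rw [← ht, hcoe _ htop, EReal.coe_le_coe_iff] at hle
        simp only [smul_eq_mul, ← ht] at hg
        simp only [hF]
        linarith
    have hopt := hstep (n + 1) (Nat.le_add_left 1 n)
    rw [Nat.add_sub_cancel] at hopt
    have hmain := hopt.gradient_step hL hgconv hgrad hlip hhconv (hεnn _)
      (hcoe _ (hxk (n + 1) (Nat.le_add_left 1 n))) hβ
    rw [hyt, hxt, norm_smul, norm_smul, Real.norm_of_nonneg hθ0.le] at hmain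
    have hδle : δ (n + 1) ≤ (1 - θ) * δ n + L / 2 * ((θ * u n) ^ 2 - (θ * u (n + 1)) ^ 2)
        + L * a (n + 1) * (θ * u (n + 1)) + ε (n + 1) := by
      simp only [hδ, hF] at hβle ⊢
      linarith
    have hscaled := mul_le_mul_of_nonneg_left hδle
      (show 0 ≤ ((n : ℝ) + 2) ^ 2 / (2 * L) by positivity)
    have hrhs : ((n : ℝ) + 2) ^ 2 / (2 * L) * ((1 - θ) * δ n
        + L / 2 * ((θ * u n) ^ 2 - (θ * u (n + 1)) ^ 2)
        + L * a (n + 1) * (θ * u (n + 1)) + ε (n + 1)) =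
        (n : ℝ) * (n + 2) / (2 * L) * δ n + u n ^ 2 - u (n + 1) ^ 2
        + (n + 2) * a (n + 1) * u (n + 1) + ((n : ℝ) + 2) ^ 2 / 2 * (ε (n + 1) / L) := by
      rw [hθ]; field_simp; ring
    rw [hrhs] at hscaled
    have hn0 : (0 : ℝ) ≤ n := n.cast_nonneg
    have hau : ((n : ℝ) + 2) * (a (n + 1) * u (n + 1)) ≤
        2 * (n + 1) * (a (n + 1) * u (n + 1)) :=
      mul_le_mul_of_nonneg_right (by linarith) (mul_nonneg (ha0 _) (norm_nonneg _))
    have hεL : ((n : ℝ) + 2) ^ 2 / 2 * (ε (n + 1) / L) ≤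
        2 * (n + 1) ^ 2 * (ε (n + 1) / L) :=
      mul_le_mul_of_nonneg_right (by nlinarith) (div_nonneg (hεnn _) hL.le)
    push_cast
    rw [mul_div_assoc (((n : ℝ) + 1) ^ 2)]
    linarith
  have hBt0 : ∀ i : ℕ, 0 ≤ (i : ℝ) ^ 2 * ε i / L := fun i =>
    div_nonneg (mul_nonneg (sq_nonneg _) (hεnn i)) hL.le
  have hsum : ∀ k : ℕ, 1 ≤ k → ((k : ℝ) + 1) ^ 2 / (2 * L) * δ k + u k ^ 2 ≤
      ‖x 0 - xstar‖ ^ 2 + 2 * Bt k + ∑ j ∈ Icc 1 k, 2 * ((j : ℝ) * a j) * u j := by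
    intro k hk
    induction k, hk using Nat.le_induction with
    | base =>
      have := hrec 0
      have hu0 : u 0 = ‖x 0 - xstar‖ := by simp [hu, hv]
      rw [hu0] at this
      simp [hBt] at this ⊢
      norm_num at this ⊢
      linarith
    | succ n hn ih =>
      have h1 := hrec n
      have h2 : (n : ℝ) * (n + 2) / (2 * L) * δ n ≤ ((n : ℝ) + 1) ^ 2 / (2 * L) * δ n := by
        have := hδ0 n hn
        gcongr
        linarith
      rw [hBt, sum_Icc_succ_top (by omega), sum_Icc_succ_top (by omega), ← hBt]
      push_cast at h1 ⊢
      rw [show (n : ℝ) + 1 + 1 = n + 2 by ring]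
      linarith
  intro k hk
  have hBmono : Monotone fun k => 2 * Bt k := fun i j hij => by
    simp only [hBt]
    gcongr
    exact fun i _ _ => hBt0 i
  have hfinal := le_sq_of_add_sq_le_add_sum (norm_nonneg (x 0 - xstar)) (fun i => norm_nonneg _)
    (fun i => mul_nonneg i.cast_nonneg (ha0 i))
    (fun i hi => mul_nonneg (by positivity) (hδ0 i hi))
    (fun i => mul_nonneg zero_le_two (by rw [hBt]; exact sum_nonneg fun i _ => hBt0 i))
    hBmono hsum hk
  rw [← hAt] at hfinal
  rw [hfF _ hhs, hfF _ (hxk k hk), ← EReal.coe_sub, EReal.coe_le_coe_iff]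
  have hk1 : (0 : ℝ) < ((k : ℝ) + 1) ^ 2 / (2 * L) := by positivity
  have hinv : 2 * L / ((k : ℝ) + 1) ^ 2 = (((k : ℝ) + 1) ^ 2 / (2 * L))⁻¹ := by rw [inv_div]
  rw [hinv, ← div_eq_inv_mul, le_div_iff₀' hk1]
  exact hfinal
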